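/- arXiv:2205.15076 — 4 statements merged into one kernel-verified Lean document; each statement's English description precedes it below -/
import Mathlib

section
/- For every natural number d there is a constant c_d > 0 with the following property: if G is a weakly observable directed graph on N vertices in which every vertex has in-degree at most d, then there exists T₀ (depending on G) such that for every T ≥ T₀ there is a policy whose regret satisfies R(T) ≤ c_d·N^{1/3}·T^{2/3} for every loss sequence ℓ^(1),…,ℓ^(T) : V → [0,1]. -/
open scoped BigOperators

/-- A policy maps the chronological history of (arm, feedback) pairs to a
probability distribution over arms.  The feedback after playing arm `a` is
recorded as a function `V → Option ℝ`, giving the observed loss on the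
out-neighbors of `a` and `none` elsewhere. -/
def Policy (V : Type) : Type :=
  List (V × (V → Option ℝ)) → PMF V

/-- The feedback revealed when arm `a` is played against the loss vector `ℓ`:
exactly the values `ℓ j` for out-neighbors `j` of `a`. -/
def feedbackOf {V : Type} (E : V → V → Bool) (ℓ : V → ℝ) (a : V) : V → Option ℝ :=
  fun j => if E a j then some (ℓ j) else none

/-- The chronological history produced by playing the arm sequence `as`
against the loss sequence `ℓ`. -/
def hist {V : Type} (E : V → V → Bool) (ℓ : ℕ → V → ℝ) (as : List V) :
    List (V × (V → Option ℝ)) :=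
  (List.range as.length).zipWith (fun t a => (a, feedbackOf E (ℓ t) a)) as

/-- Probability that the policy `π` plays exactly the arm sequence `as`
during the first `T` rounds. -/
noncomputable def seqProb {V : Type} [Fintype V] (π : Policy V) (E : V → V → Bool)
    (ℓ : ℕ → V → ℝ) (T : ℕ) (as : Fin T → V) : ℝ :=
  ∏ t : Fin T, (π (hist E ℓ ((List.ofFn as).take t.val)) (as t)).toReal

/-- Expected cumulative loss of the policy `π` over `T` rounds. -/
noncomputable def expectedLoss {V : Type} [Fintype V] (π : Policy V) (E : V → V → Bool)
    (ℓ : ℕ → V → ℝ) (T : ℕ) : ℝ :=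
  ∑ as : Fin T → V, seqProb π E ℓ T as * ∑ t : Fin T, ℓ t.val (as t)

/-- Regret of the policy `π` with respect to the fixed arm `a`. -/
noncomputable def regretTo {V : Type} [Fintype V] (π : Policy V) (E : V → V → Bool)
    (ℓ : ℕ → V → ℝ) (T : ℕ) (a : V) : ℝ :=
  expectedLoss π E ℓ T - ∑ t : Fin T, ℓ t.val a

/-- Regret of the policy `π` with respect to the best fixed arm. -/
noncomputable def regret {V : Type} [Fintype V] (π : Policy V) (E : V → V → Bool)
    (ℓ : ℕ → V → ℝ) (T : ℕ) : ℝ :=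
  expectedLoss π E ℓ T - ⨅ a : V, ∑ t : Fin T, ℓ t.val a

/-- A loss sequence taking values in `[0,1]`. -/
def ValidLoss {V : Type} (ℓ : ℕ → V → ℝ) : Prop :=
  ∀ t v, 0 ≤ ℓ t v ∧ ℓ t v ≤ 1

/-- The mini-max regret of the feedback graph `E` on `V` at horizon `T`. -/
noncomputable def minimaxRegret (V : Type) [Fintype V] (E : V → V → Bool) (T : ℕ) : ℝ :=
  ⨅ π : Policy V, ⨆ ℓ : {ℓ : ℕ → V → ℝ // ValidLoss ℓ}, regret π E ℓ.1 T

/-- A vertex is observable if it has an in-neighbor. -/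
def ObservableVertex {V : Type} (E : V → V → Bool) (v : V) : Prop :=
  ∃ u, E u v

/-- A vertex is strongly observable if it has a self-loop or is observed by
all other vertices. -/
def StronglyObservableVertex {V : Type} (E : V → V → Bool) (v : V) : Prop :=
  E v v ∨ ∀ u, u ≠ v → E u v

/-- A graph is observable if every vertex is observable. -/
def Observable {V : Type} (E : V → V → Bool) : Prop :=
  ∀ v, ObservableVertex E v

/-- A graph is strongly observable if every vertex is strongly observable. -/
def StronglyObservable {V : Type} (E : V → V → Bool) : Prop :=
  ∀ v, StronglyObservableVertex E v

/-- A graph is weakly observable if it is observable but not strongly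
observable. -/
def WeaklyObservable {V : Type} (E : V → V → Bool) : Prop :=
  Observable E ∧ ¬ StronglyObservable E

open Classical in
/-- Expectations over arm sequences grow by at most `K` per round if every conditional
one-round increment does. -/
theorem sum_seqProb_mul_le {V : Type} [Fintype V] (π : Policy V) (E : V → V → Bool)
    (ℓ : ℕ → V → ℝ) (G : List V → ℝ) (K : ℝ)
    (hG : ∀ as : List V, ∑ a, (π (hist E ℓ as) a).toReal * G (as ++ [a]) ≤ G as + K) (T : ℕ) :
    ∑ as : Fin T → V, seqProb π E ℓ T as * G (List.ofFn as) ≤ G [] + T * K ∧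
      ∑ as : Fin T → V, seqProb π E ℓ T as = 1 := by
  have hsnoc (n : ℕ) (as : Fin n → V) (a : V) :
      List.ofFn (Fin.snoc as a : Fin (n + 1) → V) = List.ofFn as ++ [a] := by
    rw [List.ofFn_succ_last]
    simp
  have hprob (n : ℕ) (as : Fin n → V) (a : V) :
      seqProb π E ℓ (n + 1) (Fin.snoc as a) =
        seqProb π E ℓ n as * (π (hist E ℓ (List.ofFn as)) a).toReal := by
    unfold seqProb
    rw [Fin.prod_univ_castSucc, hsnoc]
    congr 1
    · refine Finset.prod_congr rfl fun t _ => ?_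
      rw [Fin.snoc_castSucc, Fin.val_castSucc, List.take_append_of_le_length]
      simp [t.2.le]
    · simp
  have hsplit (n : ℕ) (H : (Fin (n + 1) → V) → ℝ) :
      ∑ as, H as = ∑ as : Fin n → V, ∑ a, H (Fin.snoc as a) := by
    rw [← (Fin.snocEquiv (fun _ => V)).sum_comp, Fintype.sum_prod_type, Finset.sum_comm]
    rfl
  have hone (h : List (V × (V → Option ℝ))) : ∑ a, (π h a).toReal = 1 := by
    rw [← ENNReal.toReal_sum fun a _ => (π h).apply_ne_top a, ← tsum_fintype (L := .unconditional V),
      (π h).tsum_coe, ENNReal.toReal_one]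
  induction T with
  | zero => simp [seqProb]
  | succ n ih =>
    rw [hsplit, hsplit]
    simp only [hprob, hsnoc, mul_assoc, ← Finset.mul_sum, hone, mul_one]
    refine ⟨?_, ih.2⟩
    calc _ ≤ ∑ as : Fin n → V, seqProb π E ℓ n as * (G (List.ofFn as) + K) := by
          refine Finset.sum_le_sum fun as _ => mul_le_mul_of_nonneg_left (hG _) ?_
          exact Finset.prod_nonneg fun _ _ => ENNReal.toReal_nonneg
      _ = (∑ as : Fin n → V, seqProb π E ℓ n as * G (List.ofFn as)) + K := by
          simp only [mul_add, Finset.sum_add_distrib, ← Finset.sum_mul, ih.2, one_mul]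
      _ ≤ G [] + ((n + 1 : ℕ) : ℝ) * K := by
          push_cast
          linarith [ih.1]

theorem hist_append_singleton {V : Type} (E : V → V → Bool) (ℓ : ℕ → V → ℝ) (as : List V)
    (a : V) :
    hist E ℓ (as ++ [a]) = hist E ℓ as ++ [(a, feedbackOf E (ℓ as.length) a)] := by
  unfold hist
  rw [List.length_append, List.length_singleton, List.range_succ, List.zipWith_append (by simp)]
  simp

/-- Square roots of the minimizer over the simplex of the linear loss `b` regularized by the
`1/2`-Tsallis entropy, characterized by the Lagrange condition. -/
theorem exists_tsallis_weights {V : Type} [Fintype V] [Nonempty V] (b : V → ℝ) :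
    ∃ w : V → ℝ, (∀ i, 0 < w i) ∧ ∑ i, w i ^ 2 = 1 ∧ ∃ c : ℝ, ∀ i, b i + c = 1 / w i := by
  obtain ⟨i₀, hi₀⟩ := Finite.exists_min b
  have hN : (1 : ℝ) ≤ Fintype.card V := by exact_mod_cast Fintype.card_pos
  have hcont : ContinuousOn (fun c : ℝ => ∑ i, (1 / (b i + c)) ^ 2)
      (Set.Icc (1 - b i₀) (Fintype.card V - b i₀)) := by
    refine continuousOn_finsetSum _ fun i _ => ContinuousOn.pow ?_ 2
    refine ContinuousOn.div continuousOn_const (by fun_prop) fun c hc => ?_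
    have := hi₀ i
    have := hc.1
    linarith
  obtain ⟨c, hc, hsum⟩ := intermediate_value_Icc' (by linarith) hcont
    (show (1 : ℝ) ∈ _ from ⟨by
      calc ∑ i, (1 / (b i + (Fintype.card V - b i₀))) ^ 2
          ≤ ∑ _i : V, 1 / (Fintype.card V : ℝ) := by
            refine Finset.sum_le_sum fun i _ => ?_
            have h1 : (Fintype.card V : ℝ) ≤ b i + (Fintype.card V - b i₀) := by linarith [hi₀ i]
            rw [div_pow, one_pow]
            exact one_div_le_one_div_of_le (by linarith) (by nlinarith)
        _ = 1 := by
            rw [Finset.sum_const, Finset.card_univ, nsmul_eq_mul]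
            field_simp, by
      refine le_trans ?_ (Finset.single_le_sum (f := fun i => (1 / (b i + (1 - b i₀))) ^ 2)
        (fun i _ => sq_nonneg _) (Finset.mem_univ i₀))
      simp⟩)
  refine ⟨fun i => 1 / (b i + c), fun i => ?_, hsum, c, fun i => by simp⟩
  have := hi₀ i
  have := hc.1
  exact one_div_pos.mpr (by linarith)

/-- The linear loss `b` regularized by the `1/2`-Tsallis entropy, at the point with
coordinates `w i ^ 2`. -/
noncomputable def tsallisObjective {V : Type} [Fintype V] (b w : V → ℝ) : ℝ :=
  ∑ i, (b i * w i ^ 2 - 2 * w i)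

/-- Stability of the regularized minimum under a nonnegative perturbation of the loss. -/
theorem tsallisObjective_add_ge {V : Type} [Fintype V] {b w v e : V → ℝ} {c : ℝ}
    (hw : ∀ i, 0 < w i) (hw1 : ∑ i, w i ^ 2 = 1) (hc : ∀ i, b i + c = 1 / w i)
    (hv : ∀ i, 0 ≤ v i) (hv1 : ∑ i, v i ^ 2 = 1) (he : ∀ i, 0 ≤ e i) :
    tsallisObjective b w + ∑ i, (e i * w i ^ 2 - w i ^ 3 * e i ^ 2) ≤
      tsallisObjective (b + e) v := by
  have hzero : ∑ i, c * (v i ^ 2 - w i ^ 2) = 0 := by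
    rw [← Finset.mul_sum, Finset.sum_sub_distrib, hv1, hw1]
    ring
  have key : ∀ i, (b i * w i ^ 2 - 2 * w i) + (e i * w i ^ 2 - w i ^ 3 * e i ^ 2) ≤
      ((b + e) i * v i ^ 2 - 2 * v i) + c * (v i ^ 2 - w i ^ 2) := by
    intro i
    have hwi := hw i
    have hvi := hv i
    have hei := he i
    have hb : b i = 1 / w i - c := by linarith [hc i]
    have hdiv : (b i + c) * (v i ^ 2 - w i ^ 2) - 2 * v i + 2 * w i = (v i - w i) ^ 2 / w i := by
      rw [hc i]
      field_simp
      ring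
    have hmain : e i * (w i ^ 2 - v i ^ 2) ≤ w i ^ 3 * e i ^ 2 + (v i - w i) ^ 2 / w i := by
      have hsq : w i ^ 3 * e i ^ 2 + (v i - w i) ^ 2 / w i =
          (w i ^ 2 * e i - (w i - v i)) ^ 2 / w i + 2 * w i * e i * (w i - v i) := by
        field_simp
        ring
      have h0 : 0 ≤ (w i ^ 2 * e i - (w i - v i)) ^ 2 / w i := by positivity
      rw [hsq]
      nlinarith [mul_nonneg hei (sq_nonneg (w i - v i))]
    simp only [Pi.add_apply]
    linarith
  calc _ = ∑ i, ((b i * w i ^ 2 - 2 * w i) + (e i * w i ^ 2 - w i ^ 3 * e i ^ 2)) := by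
        rw [tsallisObjective, ← Finset.sum_add_distrib]
    _ ≤ ∑ i, (((b + e) i * v i ^ 2 - 2 * v i) + c * (v i ^ 2 - w i ^ 2)) :=
        Finset.sum_le_sum fun i _ => key i
    _ = _ := by rw [Finset.sum_add_distrib, hzero, add_zero, tsallisObjective]

theorem sum_le_sqrt_card {V : Type} [Fintype V] {w : V → ℝ} (hw1 : ∑ i, w i ^ 2 = 1) :
    ∑ i, w i ≤ √(Fintype.card V) := by
  refine Real.le_sqrt_of_sq_le ?_
  simpa [hw1] using sq_sum_le_card_mul_sum_sq (s := Finset.univ) (f := w)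

/-- Regularized-leader weights (square roots of probabilities) for estimated losses `L`
and learning rate `η`. -/
noncomputable def tsallisWeights {V : Type} [Fintype V] [Nonempty V] (η : ℝ) (L : V → ℝ) :
    V → ℝ :=
  (exists_tsallis_weights (η • L)).choose

open Classical in
/-- Mixture of the regularized leader (weight `1 - γ`) with the choice of an observer `f j` of
an arm `j` drawn from the regularized leader (weight `γ`). -/
noncomputable def mixedProb {V : Type} [Fintype V] [Nonempty V] (f : V → V) (γ η : ℝ)
    (L : V → ℝ) (u : V) : ℝ :=
  (1 - γ) * tsallisWeights η L u ^ 2 +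
    γ * ∑ j, if f j = u then tsallisWeights η L j ^ 2 else 0

section Weights

variable {V : Type} [Fintype V] [Nonempty V] (f : V → V) {γ η : ℝ} (L : V → ℝ)

theorem tsallisWeights_pos (i : V) : 0 < tsallisWeights η L i :=
  (exists_tsallis_weights (η • L)).choose_spec.1 i

theorem sum_tsallisWeights_sq : ∑ i, tsallisWeights η L i ^ 2 = 1 :=
  (exists_tsallis_weights (η • L)).choose_spec.2.1

theorem mixedProb_nonneg (h0 : 0 ≤ γ) (h1 : γ ≤ 1) (u : V) : 0 ≤ mixedProb f γ η L u := by
  unfold mixedProb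
  refine add_nonneg (mul_nonneg (by linarith) (sq_nonneg _))
    (mul_nonneg h0 (Finset.sum_nonneg fun j _ => ?_))
  split_ifs <;> positivity

theorem le_mixedProb (h0 : 0 ≤ γ) (h1 : γ ≤ 1) (i : V) :
    γ * tsallisWeights η L i ^ 2 ≤ mixedProb f γ η L (f i) := by
  classical
  unfold mixedProb
  have h := Finset.single_le_sum
    (f := fun j => if f j = f i then tsallisWeights η L j ^ 2 else 0)
    (fun j _ => by split_ifs <;> positivity) (Finset.mem_univ i)
  simp only [if_true] at h
  have h2 : 0 ≤ (1 - γ) * tsallisWeights η L (f i) ^ 2 :=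
    mul_nonneg (by linarith) (sq_nonneg _)
  have h3 := mul_le_mul_of_nonneg_left h h0
  convert h3.trans (le_add_of_nonneg_left h2)

theorem sum_mixedProb_mul (g : V → ℝ) :
    ∑ u, mixedProb f γ η L u * g u = (1 - γ) * ∑ i, tsallisWeights η L i ^ 2 * g i +
      γ * ∑ i, tsallisWeights η L i ^ 2 * g (f i) := by
  classical
  simp only [mixedProb, add_mul, Finset.sum_add_distrib, Finset.mul_sum, Finset.sum_mul]
  congr 1
  · exact Finset.sum_congr rfl fun i _ => by ring
  · rw [Finset.sum_comm]
    refine Finset.sum_congr rfl fun j _ => ?_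
    rw [Finset.sum_eq_single (f j)]
    · simp [mul_assoc]
    · intro u _ hu
      simp [hu.symm]
    · simp

theorem sum_mixedProb : ∑ u, mixedProb f γ η L u = 1 := by
  have h := sum_mixedProb_mul f (γ := γ) (η := η) L (fun _ => 1)
  simp only [mul_one, sum_tsallisWeights_sq] at h
  linarith

open Classical in
/-- Importance-weighted update of the estimated losses after playing `o.1` and receiving the
feedback `o.2`; arm `i` is updated only when its designated observer `f i` is played. -/
noncomputable def updateEstimate (f : V → V) (γ η : ℝ) (L : V → ℝ)
    (o : V × (V → Option ℝ)) : V → ℝ :=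
  L + fun i => if f i = o.1 then (o.2 i).getD 0 / mixedProb f γ η L (f i) else 0

/-- The estimated cumulative losses after a history. -/
noncomputable def lossEstimate (f : V → V) (γ η : ℝ) (h : List (V × (V → Option ℝ))) : V → ℝ :=
  h.foldl (updateEstimate f γ η) 0

/-- The policy sampling from `mixedProb` at the current estimated losses. -/
noncomputable def mixedPolicy (f : V → V) {γ : ℝ} (η : ℝ) (h0 : 0 ≤ γ) (h1 : γ ≤ 1) :
    Policy V := fun h =>
  PMF.ofFintype (fun u => ENNReal.ofReal (mixedProb f γ η (lossEstimate f γ η h) u)) (by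
    rw [← ENNReal.ofReal_sum_of_nonneg fun u _ => mixedProb_nonneg f _ h0 h1 u,
      sum_mixedProb, ENNReal.ofReal_one])

theorem mixedPolicy_apply_toReal (h0 : 0 ≤ γ) (h1 : γ ≤ 1) (h : List (V × (V → Option ℝ)))
    (u : V) :
    (mixedPolicy f η h0 h1 h u).toReal = mixedProb f γ η (lossEstimate f γ η h) u := by
  simp [mixedPolicy, ENNReal.toReal_ofReal (mixedProb_nonneg f _ h0 h1 u)]

/-- The regularized minimum at estimated losses `L`. -/
noncomputable def tsallisMin (η : ℝ) (L : V → ℝ) : ℝ :=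
  tsallisObjective (η • L) (tsallisWeights η L)

theorem tsallisMin_add_ge (hη : 0 ≤ η) {e : V → ℝ} (he : ∀ i, 0 ≤ e i) :
    tsallisMin η L + ∑ i, (η * e i * tsallisWeights η L i ^ 2 -
      tsallisWeights η L i ^ 3 * (η * e i) ^ 2) ≤ tsallisMin η (L + e) := by
  obtain ⟨c, hc⟩ := (exists_tsallis_weights (η • L)).choose_spec.2.2
  have h := tsallisObjective_add_ge (tsallisWeights_pos L) (sum_tsallisWeights_sq L) hc
    (fun i => (tsallisWeights_pos (η := η) (L + e) i).le) (sum_tsallisWeights_sq (L + e))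
    (e := η • e) (fun i => mul_nonneg hη (he i))
  rw [tsallisMin, tsallisMin, smul_add]
  simpa [smul_add] using h

theorem tsallisMin_le (a : V) : tsallisMin η L ≤ η * L a := by
  classical
  obtain ⟨c, hc⟩ := (exists_tsallis_weights (η • L)).choose_spec.2.2
  have h := tsallisObjective_add_ge (tsallisWeights_pos L) (sum_tsallisWeights_sq L) hc
    (v := Pi.single a 1) (fun i => by by_cases h : i = a <;> simp [h])
    (by simp [Pi.single_apply]) (e := 0) (fun i => le_rfl)
  have h2 : tsallisObjective (η • L) (Pi.single a 1) = η * L a - 2 := by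
    simp [tsallisObjective, Finset.sum_sub_distrib, Pi.single_apply]
  simp only [add_zero, h2] at h
  simp only [Pi.zero_apply, zero_mul, ne_eq, OfNat.ofNat_ne_zero, not_false_eq_true, zero_pow,
    mul_zero, sub_zero, Finset.sum_const_zero, add_zero] at h
  rw [tsallisMin]
  linarith

theorem neg_le_tsallisMin_zero : -(2 * √(Fintype.card V)) ≤ tsallisMin η (0 : V → ℝ) := by
  have h := sum_le_sqrt_card (sum_tsallisWeights_sq (η := η) (0 : V → ℝ))
  simp only [tsallisMin, tsallisObjective, smul_zero, Pi.zero_apply, zero_mul, zero_sub,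
    Finset.sum_neg_distrib, ← Finset.mul_sum]
  linarith

open Classical in
/-- One-round inequality: the expected loss, plus the bias-free estimation error for the arm
`a`, is paid for by the increase of the regularized minimum. -/
theorem sum_mixedProb_mul_step_le (hγ : 0 < γ) (h1 : γ ≤ 1) (hη : 0 < η) {x : V → ℝ}
    (hx : ∀ i, 0 ≤ x i ∧ x i ≤ 1) (a : V) :
    ∑ u, mixedProb f γ η L u * (x u - x a +
        (if f a = u then x a / mixedProb f γ η L (f a) else 0) -
        (tsallisMin η (L + fun i => if f i = u then x i / mixedProb f γ η L (f i) else 0) -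
          tsallisMin η L) / η) ≤
      γ + η * √(Fintype.card V) / γ := by
  set p := mixedProb f γ η L with hp
  set w := tsallisWeights η L with hw
  have hwpos : ∀ i, 0 < w i := tsallisWeights_pos L
  have hw1 : ∑ i, w i ^ 2 = 1 := sum_tsallisWeights_sq L
  have hp0 : ∀ u, 0 ≤ p u := mixedProb_nonneg f L hγ.le h1
  have hple : ∀ i, γ * w i ^ 2 ≤ p (f i) := le_mixedProb f L hγ.le h1
  have hppos : ∀ i, 0 < p (f i) := fun i =>
    lt_of_lt_of_le (mul_pos hγ (pow_pos (hwpos i) 2)) (hple i)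
  have hp1 : ∑ u, p u = 1 := sum_mixedProb f L
  have hite (i : V) (g : ℝ) : ∑ u, p u * (if f i = u then g else 0) = p (f i) * g := by
    simp
  have hbound (u : V) :
      p u * (x u - x a + (if f a = u then x a / p (f a) else 0) -
        (tsallisMin η (L + fun i => if f i = u then x i / p (f i) else 0) -
          tsallisMin η L) / η) ≤
      p u * x u - p u * x a + p u * (if f a = u then x a / p (f a) else 0) -
        ∑ i, p u * (if f i = u then
          (x i / p (f i) * w i ^ 2 - η * w i ^ 3 * (x i / p (f i)) ^ 2) else 0) := by
    have h := tsallisMin_add_ge (η := η) L hη.le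
      (e := fun i => if f i = u then x i / p (f i) else 0)
      (fun i => by
        split_ifs
        · exact div_nonneg (hx i).1 (hp0 _)
        · exact le_rfl)
    have h2 : ∑ i, (if f i = u then
          (x i / p (f i) * w i ^ 2 - η * w i ^ 3 * (x i / p (f i)) ^ 2) else 0) ≤
        (tsallisMin η (L + fun i => if f i = u then x i / p (f i) else 0) -
          tsallisMin η L) / η := by
      rw [le_div_iff₀ hη, Finset.sum_mul]
      refine le_trans (le_of_eq ?_) (le_sub_iff_add_le'.mpr h)
      refine Finset.sum_congr rfl fun i _ => ?_
      split_ifs <;> ring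
    rw [← Finset.mul_sum]
    have h3 := mul_le_mul_of_nonneg_left h2 (hp0 u)
    linarith
  have hplay : ∑ u, p u * x u ≤ ∑ i, w i ^ 2 * x i + γ := by
    rw [hp, sum_mixedProb_mul]
    have hA : 0 ≤ ∑ i, w i ^ 2 * x i :=
      Finset.sum_nonneg fun i _ => mul_nonneg (sq_nonneg _) (hx i).1
    have hB : ∑ i, w i ^ 2 * x (f i) ≤ 1 := by
      rw [← hw1]
      exact Finset.sum_le_sum fun i _ => mul_le_of_le_one_right (sq_nonneg _) (hx _).2
    rw [← hw]
    nlinarith [mul_le_mul_of_nonneg_left hB hγ.le, mul_nonneg hγ.le hA]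
  have hsecond : ∑ i, p (f i) * (η * w i ^ 3 * (x i / p (f i)) ^ 2) ≤
      η * √(Fintype.card V) / γ := by
    calc _ ≤ ∑ i, η / γ * w i := by
          refine Finset.sum_le_sum fun i _ => ?_
          have hpi := hppos i
          have hwi := hwpos i
          have hx2 : x i ^ 2 ≤ 1 := pow_le_one₀ (hx i).1 (hx i).2
          have hl : p (f i) * (η * w i ^ 3 * (x i / p (f i)) ^ 2) =
              η * w i ^ 3 * x i ^ 2 / p (f i) := by
            field_simp
          rw [hl, div_mul_eq_mul_div, div_le_div_iff₀ hpi hγ]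
          have h4 : η * w i ^ 3 * x i ^ 2 * γ ≤ η * w i ^ 3 * 1 * γ := by gcongr
          have h5 := mul_le_mul_of_nonneg_left (hple i) (mul_pos hη hwi).le
          nlinarith
      _ ≤ _ := by
          rw [← Finset.mul_sum, mul_div_right_comm]
          exact mul_le_mul_of_nonneg_left (sum_le_sqrt_card hw1) (by positivity)
  have hfirst : ∑ i, p (f i) * (x i / p (f i) * w i ^ 2 - η * w i ^ 3 * (x i / p (f i)) ^ 2) =
      ∑ i, w i ^ 2 * x i - ∑ i, p (f i) * (η * w i ^ 3 * (x i / p (f i)) ^ 2) := by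
    rw [← Finset.sum_sub_distrib]
    refine Finset.sum_congr rfl fun i _ => ?_
    rw [mul_sub, ← mul_assoc, mul_div_cancel₀ _ (hppos i).ne', mul_comm (x i)]
  calc _ ≤ _ := Finset.sum_le_sum fun u _ => hbound u
    _ = ∑ u, p u * x u - x a + x a - ∑ i, p (f i) *
          (x i / p (f i) * w i ^ 2 - η * w i ^ 3 * (x i / p (f i)) ^ 2) := by
        rw [Finset.sum_sub_distrib, Finset.sum_add_distrib, Finset.sum_sub_distrib,
          ← Finset.sum_mul, hp1, one_mul, hite, mul_div_cancel₀ _ (hppos a).ne',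
          Finset.sum_comm]
        simp only [hite]
    _ ≤ _ := by
        rw [hfirst]
        linarith

theorem lossEstimate_hist_append (E : V → V → Bool) (hf : ∀ i, E (f i) i) (ℓ : ℕ → V → ℝ)
    (as : List V) (u : V) [DecidableEq V] :
    lossEstimate f γ η (hist E ℓ (as ++ [u])) = lossEstimate f γ η (hist E ℓ as) + fun i =>
      if f i = u then
        ℓ as.length i / mixedProb f γ η (lossEstimate f γ η (hist E ℓ as)) (f i)
      else 0 := by
  rw [hist_append_singleton, lossEstimate, List.foldl_append, ← lossEstimate]
  simp only [List.foldl_cons, List.foldl_nil, updateEstimate]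
  congr 1
  funext i
  by_cases h : f i = u
  · have hu : E u i = true := h ▸ hf i
    simp [h, feedbackOf, hu]
  · simp [h]

/-- Regret of `mixedPolicy` for general exploration and learning rates. -/
theorem regret_mixedPolicy_le (E : V → V → Bool) (hf : ∀ i, E (f i) i) (hγ : 0 < γ)
    (h1 : γ ≤ 1) (hη : 0 < η) {ℓ : ℕ → V → ℝ} (hℓ : ValidLoss ℓ) (T : ℕ) :
    regret (mixedPolicy f η hγ.le h1) E ℓ T ≤
      2 * √(Fintype.card V) / η + T * (γ + η * √(Fintype.card V) / γ) := by
  classical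
  rw [regret, sub_le_comm]
  refine le_ciInf fun a => ?_
  let est (as : List V) : V → ℝ := lossEstimate f γ η (hist E ℓ as)
  let excess (as : List V) : ℝ :=
    ∑ t : Fin as.length, (ℓ t.val as[t] - ℓ t.val a)
  have hexcess (as : List V) (u : V) :
      excess (as ++ [u]) = excess as + (ℓ as.length u - ℓ as.length a) := by
    have h (bs : List V) : excess bs =
        ∑ t ∈ Finset.range bs.length, (ℓ t (bs.getD t a) - ℓ t a) := by
      rw [Finset.sum_range]
      refine Finset.sum_congr rfl fun t _ => ?_
      simp
    rw [h, h, List.length_append, List.length_singleton, Finset.sum_range_succ]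
    congr 1
    · refine Finset.sum_congr rfl fun t ht => ?_
      rw [List.getD_append _ _ _ _ (Finset.mem_range.mp ht)]
    · simp
  let G (as : List V) : ℝ := excess as + est as a - tsallisMin η (est as) / η
  have hG (as : List V) :
      ∑ u, (mixedPolicy f η hγ.le h1 (hist E ℓ as) u).toReal * G (as ++ [u]) ≤
        G as + (γ + η * √(Fintype.card V) / γ) := by
    have hstep := sum_mixedProb_mul_step_le f (est as) hγ h1 hη (hℓ as.length) a
    have hinc (u : V) : G (as ++ [u]) = G as + (ℓ as.length u - ℓ as.length a +
        (if f a = u then ℓ as.length a / mixedProb f γ η (est as) (f a) else 0) -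
        (tsallisMin η (est as + fun i =>
            if f i = u then ℓ as.length i / mixedProb f γ η (est as) (f i) else 0) -
          tsallisMin η (est as)) / η) := by
      have he : est (as ++ [u]) = est as + fun i =>
          if f i = u then ℓ as.length i / mixedProb f γ η (est as) (f i) else 0 :=
        lossEstimate_hist_append f E hf ℓ as u
      simp only [G, hexcess, he, Pi.add_apply]
      ring
    simp only [mixedPolicy_apply_toReal, hinc, mul_add (_ : ℝ) (G as), Finset.sum_add_distrib,
      ← Finset.sum_mul, sum_mixedProb, one_mul]
    gcongr
  obtain ⟨hsum, hone⟩ := sum_seqProb_mul_le (mixedPolicy f η hγ.le h1) E ℓ G _ hG T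
  have hnil : G [] ≤ 2 * √(Fintype.card V) / η := by
    have h := div_le_div_of_nonneg_right (neg_le_tsallisMin_zero (V := V) (η := η)) hη.le
    have hG0 : G [] = -(tsallisMin η (0 : V → ℝ) / η) := by
      simp [G, excess, est, hist, lossEstimate]
    rw [hG0]
    rw [neg_div] at h
    linarith
  have hlow : expectedLoss (mixedPolicy f η hγ.le h1) E ℓ T - ∑ t : Fin T, ℓ t.val a ≤
      ∑ as : Fin T → V, seqProb (mixedPolicy f η hγ.le h1) E ℓ T as * G (List.ofFn as) := by
    rw [expectedLoss, ← one_mul (∑ t : Fin T, ℓ t.val a), ← hone, Finset.sum_mul,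
      ← Finset.sum_sub_distrib]
    refine Finset.sum_le_sum fun as _ => ?_
    rw [← mul_sub]
    refine mul_le_mul_of_nonneg_left ?_ (Finset.prod_nonneg fun _ _ => ENNReal.toReal_nonneg)
    have hmin : tsallisMin η (est (List.ofFn as)) / η ≤ est (List.ofFn as) a := by
      rw [div_le_iff₀ hη, mul_comm]
      exact tsallisMin_le _ a
    have hex : excess (List.ofFn as) = ∑ t : Fin T, ℓ t.val (as t) - ∑ t : Fin T, ℓ t.val a := by
      rw [← Finset.sum_sub_distrib]
      refine Fintype.sum_equiv (finCongr List.length_ofFn) _ _ fun t => ?_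
      simp [Fin.cast]
    simp only [G, hex]
    linarith
  linarith

end Weights

/-- For every `d` there is a constant `c_d > 0` such that every weakly
observable graph on `N` vertices with all in-degrees at most `d` admits, for all
sufficiently large `T`, a policy with regret at most `c_d · N^{1/3} · T^{2/3}` against
every loss sequence. -/
theorem bounded_in_degree_upper_bound (d : ℕ) :
    ∃ c : ℝ, 0 < c ∧
      ∀ (V : Type) [Fintype V] (E : V → V → Bool), WeaklyObservable E →
        (∀ v : V, (Finset.univ.filter (fun u => E u v)).card ≤ d) →
        ∃ T₀ : ℕ, ∀ T : ℕ, T₀ ≤ T → ∃ π : Policy V,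
          ∀ ℓ : ℕ → V → ℝ, ValidLoss ℓ →
            regret π E ℓ T ≤
              c * (Fintype.card V : ℝ) ^ ((1 : ℝ) / 3) * (T : ℝ) ^ ((2 : ℝ) / 3) := by
  refine ⟨4, by norm_num, fun V _ E hE _ => ⟨Fintype.card V, fun T hT => ?_⟩⟩
  obtain ⟨hobs, hstrong⟩ := hE
  have hne : Nonempty V := by
    by_contra h
    exact hstrong fun v => (h ⟨v⟩).elim
  choose f hf using hobs
  set N : ℝ := (Fintype.card V : ℝ) with hN
  have hN0 : 0 < N := Nat.cast_pos.mpr Fintype.card_pos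
  have hNT : N ≤ T := Nat.cast_le.mpr hT
  have hT0 : (0 : ℝ) < T := hN0.trans_le hNT
  set r : ℝ := N ^ ((1 : ℝ) / 3) with hr
  set s : ℝ := (T : ℝ) ^ ((1 : ℝ) / 3) with hs
  have hr0 : 0 < r := Real.rpow_pos_of_pos hN0 _
  have hs0 : 0 < s := Real.rpow_pos_of_pos hT0 _
  have hr3 : N = r ^ 3 := by
    rw [hr, ← Real.rpow_natCast, ← Real.rpow_mul hN0.le]
    norm_num
  have hs3 : (T : ℝ) = s ^ 3 := by
    rw [hs, ← Real.rpow_natCast, ← Real.rpow_mul hT0.le]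
    norm_num
  have hs2 : (T : ℝ) ^ ((2 : ℝ) / 3) = s ^ 2 := by
    rw [hs, ← Real.rpow_natCast, ← Real.rpow_mul hT0.le]
    norm_num
  have hrs : r ≤ s := Real.rpow_le_rpow hN0.le hNT (by norm_num)
  have hγ : 0 < r / s := by positivity
  have hγ1 : r / s ≤ 1 := (div_le_one hs0).mpr hrs
  have hη : 0 < √r / s ^ 2 := by positivity
  refine ⟨mixedPolicy f (√r / s ^ 2) hγ.le hγ1, fun ℓ hℓ => ?_⟩
  refine (regret_mixedPolicy_le f E hf hγ hγ1 hη hℓ T).trans (le_of_eq ?_)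
  rw [← hN, hs2, hs3, hr3]
  obtain ⟨q, hq0, hq⟩ : ∃ q : ℝ, 0 < q ∧ r = q ^ 2 :=
    ⟨√r, by positivity, (Real.sq_sqrt hr0.le).symm⟩
  have hsqrt : √(r ^ 3) = q ^ 3 := by
    rw [hq, ← pow_mul, show 2 * 3 = 3 * 2 from rfl, pow_mul, Real.sqrt_sq (by positivity)]
  rw [hsqrt, hq, Real.sqrt_sq hq0.le]
  field_simp
  ring
end

section
/- For every n ≥ 1 there exists a set D ⊆ {0,1}^n such that: (i) D is a dominating set of the hypercube Q_n (every vertex of {0,1}^n either lies in D or is adjacent in Q_n to a vertex of D); (ii) D can be partitioned into |D|/2 pairs of vertices such that the two vertices in each pair are adjacent in Q_n (equivalently, the subgraph of Q_n induced by D contains a perfect matching); and (iii) |D| = 2^{n+1−k}, where k = ⌊log₂(n+1)⌋; in particular |D| ≤ 2^{n+2}/(n+1). -/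
/-- Adjacency in the hypercube `Q_n`: two vertices of `{0,1}^n` are adjacent iff their
Hamming distance is exactly `1`. -/
def hammingAdj {n : ℕ} (u v : Fin n → Bool) : Prop :=
  (Finset.univ.filter (fun i => u i ≠ v i)).card = 1

instance {n : ℕ} : DecidableRel (@hammingAdj n) := fun u v => by
  unfold hammingAdj; infer_instance

/-- Negate the `j`-th coordinate of a vertex of the hypercube. -/
def flipCoord {n : ℕ} (j : Fin n) (v : Fin n → Bool) : Fin n → Bool :=
  Function.update v j (!v j)

theorem flipCoord_involutive {n : ℕ} (j : Fin n) : Function.Involutive (flipCoord j) := by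
  intro v
  simp [flipCoord]

theorem hammingAdj_flipCoord {n : ℕ} (j : Fin n) (v : Fin n → Bool) :
    hammingAdj v (flipCoord j v) := by
  unfold hammingAdj
  rw [Finset.card_eq_one]
  refine ⟨j, ?_⟩
  ext i
  rw [Finset.mem_filter, Finset.mem_singleton]
  by_cases h : i = j
  · subst h; simp [flipCoord]
  · simp [flipCoord, h]

theorem flipCoord_ne {n : ℕ} (j : Fin n) (v : Fin n → Bool) : flipCoord j v ≠ v := by
  intro h
  simpa [flipCoord] using congrFun h j

/-- The sum of the `h i` over the support of `v`. When the `h i` are the columns of a parity-check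
matrix, this is the syndrome of `v`. -/
def syndrome {n : ℕ} {S : Type*} [AddCommGroup S] (h : Fin n → S) (v : Fin n → Bool) : S :=
  ∑ i, if v i then h i else 0

theorem syndrome_flipCoord {n : ℕ} {S : Type*} [AddCommGroup S] (hS : ∀ s : S, s + s = 0)
    (h : Fin n → S) (j : Fin n) (v : Fin n → Bool) :
    syndrome h (flipCoord j v) = syndrome h v + h j := by
  unfold syndrome
  rw [← Finset.add_sum_erase _ _ (Finset.mem_univ j),
    ← Finset.add_sum_erase _ (fun i => if v i then h i else 0) (Finset.mem_univ j)]
  have hsum : ∑ i ∈ Finset.univ.erase j, (if flipCoord j v i then h i else 0) =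
      ∑ i ∈ Finset.univ.erase j, (if v i then h i else 0) := by
    refine Finset.sum_congr rfl fun i hi => ?_
    simp [flipCoord, Finset.ne_of_mem_erase hi]
  rw [hsum, add_right_comm]
  cases hv : v j <;> simp [flipCoord, hv, hS]

theorem card_syndrome_fiber_column {n : ℕ} {S : Type*} [AddCommGroup S] [DecidableEq S]
    (hS : ∀ s : S, s + s = 0) (h : Fin n → S) (j : Fin n) :
    (Finset.univ.filter fun v => syndrome h v = h j).card =
      (Finset.univ.filter fun v => syndrome h v = 0).card := by
  refine Finset.card_nbij' (flipCoord j) (flipCoord j) ?_ ?_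
    (fun v _ => flipCoord_involutive j v) (fun v _ => flipCoord_involutive j v)
  · intro v hv
    have hv' : syndrome h v = h j := by simpa using hv
    simp [syndrome_flipCoord hS, hv', hS]
  · intro v hv
    have hv' : syndrome h v = 0 := by simpa using hv
    simp [syndrome_flipCoord hS, hv']

theorem card_mul_card_syndrome_fiber_zero {n : ℕ} {S : Type*} [AddCommGroup S] [Fintype S]
    [DecidableEq S] (hS : ∀ s : S, s + s = 0) (h : Fin n → S)
    (hh : ∀ s : S, s ≠ 0 → ∃ j, h j = s) :
    Fintype.card S * (Finset.univ.filter fun v => syndrome h v = 0).card = 2 ^ n := by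
  have hfib : ∀ s : S, (Finset.univ.filter fun v => syndrome h v = s).card =
      (Finset.univ.filter fun v => syndrome h v = 0).card := by
    intro s
    by_cases hs : s = 0
    · rw [hs]
    · obtain ⟨j, rfl⟩ := hh s hs
      exact card_syndrome_fiber_column hS h j
  have hcard := Finset.card_eq_sum_card_fiberwise (f := syndrome h)
    (s := (Finset.univ : Finset (Fin n → Bool))) (t := Finset.univ)
    (fun _ _ => Finset.mem_coe.2 (Finset.mem_univ _))
  simpa [hfib] using hcard.symm

theorem exists_forall_ne_zero_exists_eq {n : ℕ} {S : Type*} [Zero S] [Fintype S]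
    (hcard : Fintype.card S ≤ n + 1) :
    ∃ h : Fin n → S, ∀ s, s ≠ 0 → ∃ j, h j = s := by
  classical
  have hle : Fintype.card {s : S // s ≠ 0} ≤ Fintype.card (Fin n) := by
    rw [Fintype.card_subtype_compl, Fintype.card_subtype_eq, Fintype.card_fin]
    omega
  obtain ⟨e⟩ := Function.Embedding.nonempty_of_card_le hle
  exact ⟨Function.extend e Subtype.val 0, fun s hs => ⟨e ⟨s, hs⟩, e.injective.extend_apply _ _ _⟩⟩

/-- For every `n ≥ 1` there is a set `D ⊆ {0,1}^n` that (i) dominates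
the hypercube `Q_n`, (ii) can be split into `|D|/2` adjacent pairs (equivalently the
subgraph induced by `D` has a perfect matching, expressed here as a fixed-point-free
involution of `D` matching adjacent vertices), and (iii) has cardinality
`2^{n+1-⌊log₂(n+1)⌋}`; in particular `|D| ≤ 2^{n+2}/(n+1)`. -/
theorem hypercube_dominating_matched_set (n : ℕ) (hn : 1 ≤ n) :
    ∃ D : Finset (Fin n → Bool),
      (∀ v : Fin n → Bool, v ∈ D ∨ ∃ u ∈ D, hammingAdj v u) ∧
      (∃ f : {v // v ∈ D} → {v // v ∈ D}, Function.Involutive f ∧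
        ∀ v : {v // v ∈ D}, f v ≠ v ∧ hammingAdj v.1 (f v).1) ∧
      D.card = 2 ^ (n + 1 - Nat.log 2 (n + 1)) ∧
      (D.card : ℝ) ≤ 2 ^ (n + 2) / ((n : ℝ) + 1) := by
  set k := Nat.log 2 (n + 1) with hk
  have hk_le : 2 ^ k ≤ n + 1 := Nat.pow_log_le_self 2 (by omega)
  have hk_lt : n + 1 < 2 ^ (k + 1) := Nat.lt_pow_succ_log_self (by norm_num) _
  have hk_pos : 1 ≤ k := Nat.log_pos (by norm_num) (by omega)
  have hkn : k ≤ n := by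
    have := k.lt_two_pow_self
    omega
  have hS : ∀ s : Fin k → ZMod 2, s + s = 0 := fun s => funext fun i => CharTwo.add_self_eq_zero _
  have hScard : Fintype.card (Fin k → ZMod 2) = 2 ^ k := by simp
  obtain ⟨h, hh⟩ := exists_forall_ne_zero_exists_eq (n := n) (hScard.trans_le hk_le)
  obtain ⟨j, hj⟩ : ∃ j, h j ≠ 0 := by
    have hne : (fun _ => 1 : Fin k → ZMod 2) ≠ 0 := fun h0 => by
      simpa using congrFun h0 ⟨0, hk_pos⟩
    obtain ⟨j, hj⟩ := hh _ hne
    exact ⟨j, hj ▸ hne⟩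
  let D : Finset (Fin n → Bool) := Finset.univ.filter fun v => syndrome h v = 0 ∨ syndrome h v = h j
  have hD : ∀ v, v ∈ D ↔ syndrome h v = 0 ∨ syndrome h v = h j := fun v => by simp [D]
  have hflip : ∀ v ∈ D, flipCoord j v ∈ D := by
    intro v hv
    rw [hD] at hv ⊢
    rw [syndrome_flipCoord hS]
    rcases hv with hv | hv
    · exact Or.inr (by rw [hv, zero_add])
    · exact Or.inl (by rw [hv, hS])
  have hDcard : D.card = 2 ^ (n + 1 - k) := by
    have hdisj : Disjoint (Finset.univ.filter fun v => syndrome h v = 0)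
        (Finset.univ.filter fun v => syndrome h v = h j) := by
      refine Finset.disjoint_filter.2 fun v _ h0 h1 => hj (h1.symm.trans h0)
    have hc := card_mul_card_syndrome_fiber_zero hS h hh
    rw [hScard] at hc
    have hD2 : D.card = 2 * (Finset.univ.filter fun v => syndrome h v = 0).card := by
      simp only [D]
      rw [Finset.filter_or, Finset.card_union_of_disjoint hdisj, card_syndrome_fiber_column hS,
        two_mul]
    refine Nat.eq_of_mul_eq_mul_left (Nat.two_pow_pos k) ?_
    rw [← pow_add, Nat.add_sub_cancel' (by omega), hD2, mul_left_comm, hc, pow_succ']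
  refine ⟨D, fun v => ?_, ⟨fun v => ⟨flipCoord j v, hflip v v.2⟩, fun v => ?_, fun v => ⟨?_, ?_⟩⟩,
    hDcard, ?_⟩
  · by_cases hv : syndrome h v = 0
    · exact Or.inl ((hD v).2 (Or.inl hv))
    · obtain ⟨i, hi⟩ := hh _ hv
      refine Or.inr ⟨flipCoord i v, (hD _).2 (Or.inl ?_), hammingAdj_flipCoord i v⟩
      rw [syndrome_flipCoord hS, hi, hS]
  · exact Subtype.ext (flipCoord_involutive j v)
  · exact fun hv => flipCoord_ne j v (congrArg Subtype.val hv)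
  · exact hammingAdj_flipCoord j v
  · rw [le_div_iff₀ (by positivity), hDcard]
    have hmul : 2 ^ (n + 1 - k) * (n + 1) ≤ 2 ^ (n + 2) :=
      calc 2 ^ (n + 1 - k) * (n + 1) ≤ 2 ^ (n + 1 - k) * 2 ^ (k + 1) :=
            Nat.mul_le_mul_left _ hk_lt.le
        _ = 2 ^ (n + 2) := by rw [← pow_add]; congr 1; omega
    exact_mod_cast hmul
end

section
/- Let G = (V,E) be an observable directed graph (every vertex has at least one in-neighbor) and let U ⊆ V be the set of vertices of G that are not strongly observable; assume U ≠ ∅. Then there exists a set W with U ⊆ W ⊆ V and |W| ≤ 2|U| such that the subgraph of G induced by W is observable, i.e., every vertex of W has an in-neighbor belonging to W. -/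
/-- Let `G` be an observable directed graph and let `U ≠ ∅` be the set
of its vertices that are not strongly observable.  Then there is a set `W` with
`U ⊆ W` and `|W| ≤ 2|U|` such that the subgraph induced by `W` is observable: every
vertex of `W` has an in-neighbor inside `W`. -/
theorem corrupted_vertices_observable_extension {V : Type} [Fintype V]
    (E : V → V → Bool)
    (hobs : ∀ v : V, ∃ u, E u v)
    (U : Set V) (hU : U = {v : V | ¬ StronglyObservableVertex E v})
    (hUne : U.Nonempty) :
    ∃ W : Finset V, U ⊆ ↑W ∧ W.card ≤ 2 * U.ncard ∧
      ∀ v ∈ W, ∃ u ∈ W, E u v := by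
  classical
  choose f hf using hobs
  obtain ⟨u₀, hu₀⟩ := hUne
  refine ⟨U.toFinset ∪ U.toFinset.image f, fun v hv => by simp [hv], ?_, fun v hv => ?_⟩
  · have h_union := Finset.card_union_le U.toFinset (U.toFinset.image f)
    have h_image := Finset.card_image_le (s := U.toFinset) (f := f)
    rw [Set.ncard_eq_toFinset_card']
    omega
  · by_cases hvU : v ∈ U
    · exact ⟨f v, Finset.mem_union_right _
        (Finset.mem_image_of_mem f (Set.mem_toFinset.2 hvU)), hf v⟩
    · have h_strong : StronglyObservableVertex E v := by
        simpa [hU] using hvU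
      rcases h_strong with h_loop | h_all
      · exact ⟨v, hv, h_loop⟩
      · exact ⟨u₀, Finset.mem_union_left _ (Set.mem_toFinset.2 hu₀),
          h_all u₀ fun h => hvU (h ▸ hu₀)⟩
end

section
/- Let η₀ > 0, let y ∈ (0,1], and let l ∈ ℝ satisfy η₀·l ≥ −1/4. Define φ(x) = −√x/η₀ for x ≥ 0 and f(x) = l·x + φ(x) − φ(y) − φ'(y)·(x − y), where φ'(y) = −1/(2η₀√y). Then f attains its minimum over [0,∞) at the unique point w = y/(1 + 2η₀·l·√y)², and this minimizer satisfies w ≤ 4y. -/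
/-- For `η₀ > 0`, `y ∈ (0,1]` and `l` with `η₀·l ≥ -1/4`, the
one-dimensional mirror-descent objective
`f(x) = l·x + φ(x) - φ(y) - φ'(y)·(x - y)` for the Tsallis potential
`φ(x) = -√x/η₀` (so `φ'(y) = -1/(2η₀√y)`) attains its minimum over `[0,∞)` at the
unique point `w = y/(1 + 2η₀·l·√y)²`, and `w ≤ 4y`. -/
theorem tsallis_one_dim_minimizer (η₀ y l : ℝ) (hη : 0 < η₀)
    (hy : 0 < y) (hy1 : y ≤ 1) (hl : -(1 / 4) ≤ η₀ * l)
    (f : ℝ → ℝ)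
    (hf : ∀ x, f x = l * x + (-Real.sqrt x / η₀) - (-Real.sqrt y / η₀) -
      (-1 / (2 * η₀ * Real.sqrt y)) * (x - y))
    (w : ℝ) (hw : w = y / (1 + 2 * η₀ * l * Real.sqrt y) ^ 2) :
    (0 ≤ w) ∧ (∀ x, 0 ≤ x → f w ≤ f x) ∧
      (∀ x, 0 ≤ x → (∀ z, 0 ≤ z → f x ≤ f z) → x = w) ∧
      w ≤ 4 * y := by
  have hs : 0 < √y := Real.sqrt_pos.2 hy
  have hs1 : √y ≤ 1 := Real.sqrt_le_one.2 hy1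
  have hsy : √y ^ 2 = y := Real.sq_sqrt hy.le
  have ht : 1 / 2 ≤ 1 + 2 * η₀ * l * √y := by nlinarith
  have ht0 : 0 < 1 + 2 * η₀ * l * √y := by linarith
  have hw0 : 0 ≤ w := by rw [hw]; positivity
  have hsw : √w = √y / (1 + 2 * η₀ * l * √y) := by
    rw [hw, Real.sqrt_div hy.le, Real.sqrt_sq ht0.le]
  have gap : ∀ x, 0 ≤ x →
      f x - f w = (1 + 2 * η₀ * l * √y) / (2 * η₀ * √y) * (√x - √w) ^ 2 := by
    intro x hx
    have hslope : (1 + 2 * η₀ * l * √y) / (2 * η₀ * √y) * (2 * √w) = 1 / η₀ := by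
      rw [hsw]; field_simp
    have hcoef : (1 + 2 * η₀ * l * √y) / (2 * η₀ * √y) = l + 1 / (2 * η₀ * √y) := by
      field_simp; ring
    rw [hcoef] at hslope ⊢
    rw [hf, hf]
    linear_combination (√w - √x) * -hslope -
      (l + 1 / (2 * η₀ * √y)) * (Real.sq_sqrt hx - Real.sq_sqrt hw0)
  have hcurv : 0 < (1 + 2 * η₀ * l * √y) / (2 * η₀ * √y) := by positivity
  refine ⟨hw0, fun x hx => ?_, fun x hx hmin => ?_, ?_⟩
  · have := gap x hx
    have : 0 ≤ f x - f w := by rw [this]; positivity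
    linarith
  · have hle : (1 + 2 * η₀ * l * √y) / (2 * η₀ * √y) * (√x - √w) ^ 2 ≤ 0 := by
      rw [← gap x hx]; linarith [hmin w hw0]
    have hsq : (√x - √w) ^ 2 = 0 :=
      le_antisymm (nonpos_of_mul_nonpos_right hle hcurv) (sq_nonneg _)
    exact (Real.sqrt_inj hx hw0).1 (sub_eq_zero.1 (pow_eq_zero_iff two_ne_zero |>.1 hsq))
  · rw [hw, div_le_iff₀ (by positivity)]
    have : 1 / 4 ≤ (1 + 2 * η₀ * l * √y) ^ 2 := by nlinarith
    nlinarith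
end
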